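/- arXiv:1111.4937 — 3 statements merged into one kernel-verified Lean document; each statement's English description precedes it below -/
import Mathlib

section
/- Let R be a staircase with at least two blocks and m steps, and let r = [x1,x2]×[y1,y2] ∈ R be a deletable rectangle of type (1,1) whose top edge lies on the j-th step of R. Then R ∖ {r} is a staircase with exactly m+1 steps. -/
open Set

/-- A block is a closed axis-parallel rectangle `[x1,x2] × [y1,y2]` with `x1 < x2`, `y1 < y2`. -/
def IsBlock (b : Set (ℝ × ℝ)) : Prop :=
  ∃ x1 x2 y1 y2 : ℝ, x1 < x2 ∧ y1 < y2 ∧ b = Icc x1 x2 ×ˢ Icc y1 y2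

/-- `R` is a staircase with `m` steps, step x-coordinates `a 0 < a 1 < ⋯ < a m`
(with `a 0 = 0`) and step heights `h 1 > h 2 > ⋯ > h m > 0`. -/
def IsStaircaseWith (R : Finset (Set (ℝ × ℝ))) (m : ℕ) (a h : ℕ → ℝ) : Prop :=
  R.Nonempty ∧
  (∀ b ∈ R, IsBlock b) ∧
  (∀ b ∈ R, ∀ b' ∈ R, b ≠ b' → interior b ∩ interior b' = ∅) ∧
  (∀ (p : ℝ × ℝ) (b1 b2 b3 b4 : Set (ℝ × ℝ)),
      b1 ∈ R → b2 ∈ R → b3 ∈ R → b4 ∈ R →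
      p ∈ b1 → p ∈ b2 → p ∈ b3 → p ∈ b4 →
      b1 = b2 ∨ b1 = b3 ∨ b1 = b4 ∨ b2 = b3 ∨ b2 = b4 ∨ b3 = b4) ∧
  1 ≤ m ∧
  a 0 = 0 ∧
  (∀ j, j < m → a j < a (j + 1)) ∧
  (∀ j, 1 ≤ j → j < m → h (j + 1) < h j) ∧
  0 < h m ∧
  ⋃₀ (R : Set (Set (ℝ × ℝ))) =
    ⋃ j ∈ Finset.Icc 1 m, Icc (a (j - 1)) (a j) ×ˢ Icc (0 : ℝ) (h j)

/-- `R` is a staircase. -/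
def IsStaircase (R : Finset (Set (ℝ × ℝ))) : Prop :=
  ∃ m a h, IsStaircaseWith R m a h

/-- `r` is a deletable rectangle of `R`: a block of `R` whose top edge and right
edge are both contained in the topological boundary of `⋃ R`. -/
def IsDeletable (R : Finset (Set (ℝ × ℝ))) (r : Set (ℝ × ℝ)) : Prop :=
  r ∈ R ∧ ∃ x1 x2 y1 y2 : ℝ, x1 < x2 ∧ y1 < y2 ∧ r = Icc x1 x2 ×ˢ Icc y1 y2 ∧
    (Icc x1 x2 ×ˢ ({y2} : Set ℝ)) ⊆ frontier (⋃₀ (R : Set (Set (ℝ × ℝ)))) ∧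
    (({x2} : Set ℝ) ×ˢ Icc y1 y2) ⊆ frontier (⋃₀ (R : Set (Set (ℝ × ℝ))))

/-- A mosaic floorplan is a staircase with exactly one step. -/
def IsMosaicFloorplan (M : Finset (Set (ℝ × ℝ))) : Prop :=
  ∃ a h, IsStaircaseWith M 1 a h

noncomputable instance : DecidableEq (Set (ℝ × ℝ)) := Classical.decEq _

theorem mem_stepRegion {m : ℕ} {a h : ℕ → ℝ} {p : ℝ × ℝ} :
    p ∈ (⋃ j ∈ Finset.Icc 1 m, Icc (a (j - 1)) (a j) ×ˢ Icc (0 : ℝ) (h j)) ↔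
      ∃ i, 1 ≤ i ∧ i ≤ m ∧ a (i - 1) ≤ p.1 ∧ p.1 ≤ a i ∧ 0 ≤ p.2 ∧ p.2 ≤ h i := by
  simp only [mem_iUnion, Finset.mem_Icc, mem_prod, mem_Icc, exists_prop]
  exact exists_congr fun i => by tauto

theorem le_of_steps_increasing {m : ℕ} {a : ℕ → ℝ} (ha : ∀ j, j < m → a j < a (j + 1))
    {i k : ℕ} (hik : i ≤ k) (hk : k ≤ m) : a i ≤ a k := by
  induction k, hik using Nat.le_induction with
  | base => exact le_rfl
  | succ k _ ih => exact (ih (by omega)).trans (ha k (by omega)).le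

theorem le_of_heights_decreasing {m : ℕ} {h : ℕ → ℝ}
    (hh : ∀ j, 1 ≤ j → j < m → h (j + 1) < h j)
    {i k : ℕ} (hi : 1 ≤ i) (hik : i ≤ k) (hk : k ≤ m) : h k ≤ h i := by
  induction k, hik using Nat.le_induction with
  | base => exact le_rfl
  | succ k _ ih => exact (hh k (by omega) (by omega)).le.trans (ih (by omega))

theorem IsBlock.isClosed {b : Set (ℝ × ℝ)} (hb : IsBlock b) : IsClosed b := by
  obtain ⟨x1, x2, y1, y2, -, -, rfl⟩ := hb
  exact isClosed_Icc.prod isClosed_Icc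

theorem IsBlock.subset_closure_interior {b : Set (ℝ × ℝ)} (hb : IsBlock b) :
    b ⊆ closure (interior b) := by
  obtain ⟨x1, x2, y1, y2, hx, hy, rfl⟩ := hb
  rw [interior_prod_eq, interior_Icc, interior_Icc, closure_prod_eq, closure_Ioo hx.ne,
    closure_Ioo hy.ne]

/-- The abscissae of the steps after the `j`-th step has been split at abscissa `x`. -/
noncomputable def splitAbscissa (a : ℕ → ℝ) (j : ℕ) (x : ℝ) (i : ℕ) : ℝ :=
  if i < j then a i else if i = j then x else a (i - 1)

/-- The heights of the steps after the right part of the `j`-th step has been lowered to `y`. -/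
noncomputable def splitHeight (h : ℕ → ℝ) (j : ℕ) (y : ℝ) (i : ℕ) : ℝ :=
  if i ≤ j then h i else if i = j + 1 then y else h (i - 1)

theorem splitAbscissa_lt_succ {m : ℕ} {a : ℕ → ℝ} (ha : ∀ j, j < m → a j < a (j + 1))
    {j : ℕ} (hj : 1 ≤ j) (hjm : j ≤ m) {x : ℝ} (hleft : a (j - 1) < x) (hright : x < a j)
    {i : ℕ} (hi : i < m + 1) : splitAbscissa a j x i < splitAbscissa a j x (i + 1) := by
  unfold splitAbscissa
  rcases lt_trichotomy (i + 1) j with hij | rfl | hij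
  · rw [if_pos (by omega), if_pos hij]
    exact ha i (by omega)
  · simpa using hleft
  · rcases (show i = j ∨ j < i by omega) with rfl | hij'
    · simpa using hright
    · obtain ⟨k, rfl⟩ : ∃ k, i = k + 1 := ⟨i - 1, by omega⟩
      rw [if_neg (by omega), if_neg (by omega), if_neg (by omega), if_neg (by omega)]
      exact ha k (by omega)

theorem splitHeight_succ_lt {m : ℕ} {h : ℕ → ℝ} (hh : ∀ j, 1 ≤ j → j < m → h (j + 1) < h j)
    {j : ℕ} (hjm : j ≤ m) {y : ℝ} (htop : y < h j) (hbot : j < m → h (j + 1) < y)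
    {i : ℕ} (hi : 1 ≤ i) (him : i < m + 1) :
    splitHeight h j y (i + 1) < splitHeight h j y i := by
  unfold splitHeight
  rcases lt_trichotomy i j with hij | rfl | hij
  · rw [if_pos (by omega), if_pos (by omega)]
    exact hh i hi (by omega)
  · simpa using htop
  · rcases (show i = j + 1 ∨ j + 1 < i by omega) with rfl | hij'
    · simpa using hbot (by omega)
    · obtain ⟨k, rfl⟩ : ∃ k, i = k + 1 := ⟨i - 1, by omega⟩
      rw [if_neg (by omega), if_neg (by omega), if_neg (by omega), if_neg (by omega)]
      exact hh k (by omega) (by omega)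

/-- Splitting the `j`-th step removes exactly the open quadrant above and to the right of the
new corner from the region under the steps. -/
theorem mem_splitRegion {m : ℕ} {a h : ℕ → ℝ} (ha : ∀ j, j < m → a j < a (j + 1))
    (hh : ∀ j, 1 ≤ j → j < m → h (j + 1) < h j)
    {j : ℕ} (hj : 1 ≤ j) (hjm : j ≤ m) {x y : ℝ} (hleft : a (j - 1) < x) (hright : x < a j)
    (htop : y < h j) (hbot : j < m → h (j + 1) < y) {p : ℝ × ℝ} :
    p ∈ (⋃ i ∈ Finset.Icc 1 (m + 1),
        Icc (splitAbscissa a j x (i - 1)) (splitAbscissa a j x i) ×ˢ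
          Icc (0 : ℝ) (splitHeight h j y i)) ↔
      p ∈ (⋃ i ∈ Finset.Icc 1 m, Icc (a (i - 1)) (a i) ×ˢ Icc (0 : ℝ) (h i)) ∧
        (p.1 ≤ x ∨ p.2 ≤ y) := by
  rw [mem_stepRegion, mem_stepRegion]
  have hlow : ∀ i, i < j → splitAbscissa a j x i = a i := fun i hi => if_pos hi
  have hmid : splitAbscissa a j x j = x := by simp [splitAbscissa]
  have hhigh : ∀ i, j ≤ i → splitAbscissa a j x (i + 1) = a i := fun i hi => by
    unfold splitAbscissa
    rw [if_neg (by omega), if_neg (by omega), Nat.add_sub_cancel]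
  have hlow' : ∀ i, i ≤ j → splitHeight h j y i = h i := fun i hi => if_pos hi
  have hmid' : splitHeight h j y (j + 1) = y := by simp [splitHeight]
  have hhigh' : ∀ i, j < i → splitHeight h j y (i + 1) = h i := fun i hi => by
    unfold splitHeight
    rw [if_neg (by omega), if_neg (by omega), Nat.add_sub_cancel]
  constructor
  · rintro ⟨i, hi, him, h1, h2, h3, h4⟩
    rcases lt_trichotomy i j with hij | rfl | hij
    · rw [hlow _ (by omega)] at h1 h2
      rw [hlow' _ hij.le] at h4
      refine ⟨⟨i, hi, by omega, h1, h2, h3, h4⟩, Or.inl ?_⟩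
      have := le_of_steps_increasing ha (show i ≤ j - 1 by omega) (by omega)
      linarith
    · rw [hlow _ (by omega)] at h1
      rw [hmid] at h2
      rw [hlow' _ le_rfl] at h4
      exact ⟨⟨i, hi, hjm, h1, by linarith, h3, h4⟩, Or.inl h2⟩
    · obtain ⟨k, rfl⟩ : ∃ k, i = k + 1 := ⟨i - 1, by omega⟩
      rw [Nat.add_sub_cancel] at h1
      rw [hhigh _ (by omega)] at h2
      rcases (show k = j ∨ j < k by omega) with rfl | hjk
      · rw [hmid] at h1
        rw [hmid'] at h4
        exact ⟨⟨k, hj, hjm, by linarith, h2, h3, by linarith⟩, Or.inr h4⟩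
      · rw [hhigh' _ hjk] at h4
        have h1' : a (k - 1) ≤ p.1 := by
          rw [← hhigh (k - 1) (by omega), Nat.sub_add_cancel (by omega)]
          exact h1
        refine ⟨⟨k, by omega, by omega, h1', h2, h3, h4⟩, Or.inr ?_⟩
        have := le_of_heights_decreasing hh (show 1 ≤ j + 1 by omega) hjk (by omega)
        have := hbot (by omega)
        linarith
  · rintro ⟨⟨i, hi, him, h1, h2, h3, h4⟩, hp⟩
    rcases lt_trichotomy i j with hij | rfl | hij
    · refine ⟨i, hi, by omega, ?_, ?_, h3, ?_⟩
      · rwa [hlow _ (by omega)]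
      · rwa [hlow _ hij]
      · rwa [hlow' _ hij.le]
    · by_cases hpx : p.1 ≤ x
      · refine ⟨i, hi, by omega, ?_, ?_, h3, ?_⟩
        · rwa [hlow _ (by omega)]
        · rwa [hmid]
        · rwa [hlow' _ le_rfl]
      · refine ⟨i + 1, by omega, by omega, ?_, ?_, h3, ?_⟩
        · rw [Nat.add_sub_cancel, hmid]
          exact (not_le.mp hpx).le
        · rwa [hhigh _ le_rfl]
        · rw [hmid']
          exact hp.resolve_left hpx
    · refine ⟨i + 1, by omega, by omega, ?_, ?_, h3, ?_⟩
      · rw [Nat.add_sub_cancel]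
        have := hhigh (i - 1) (by omega)
        rw [Nat.sub_add_cancel hi] at this
        rwa [this]
      · rwa [hhigh _ hij.le]
      · rwa [hhigh' _ hij]

/-- A point under the steps that lies above and to the right of `(x, y)`, a point in the part of
the `j`-th column above the next step, belongs to the rectangle cut off by `(x, y)`. -/
theorem mem_corner_of_mem_stepRegion {m : ℕ} {a h : ℕ → ℝ} (ha : ∀ j, j < m → a j < a (j + 1))
    (hh : ∀ j, 1 ≤ j → j < m → h (j + 1) < h j)
    {j : ℕ} (hjm : j ≤ m) {x y : ℝ} (hleft : a (j - 1) < x)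
    (hbot : j < m → h (j + 1) < y) {p : ℝ × ℝ}
    (hp : p ∈ (⋃ i ∈ Finset.Icc 1 m, Icc (a (i - 1)) (a i) ×ˢ Icc (0 : ℝ) (h i)))
    (hpx : x < p.1) (hpy : y < p.2) : p ∈ Icc x (a j) ×ˢ Icc y (h j) := by
  obtain ⟨i, hi, him, h1, h2, h3, h4⟩ := mem_stepRegion.mp hp
  rcases lt_trichotomy i j with hij | rfl | hij
  · have := le_of_steps_increasing ha (show i ≤ j - 1 by omega) (by omega)
    linarith
  · exact ⟨⟨hpx.le, h2⟩, hpy.le, h4⟩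
  · have := le_of_heights_decreasing hh (show 1 ≤ j + 1 by omega) hij him
    have := hbot (by omega)
    linarith

/-- Let `R` be a staircase with at least two blocks and `m`
steps, and let `r = [x1,x2] × [y1,y2] ∈ R` be a deletable rectangle of type
`(1,1)` whose top edge lies on the `j`-th step of `R` (so `y2 = h j` and
`x2 = a j`; here `h'` is `h (j+1)` if `j < m` and `0` if `j = m`).
Then `R \ {r}` is a staircase with exactly `m + 1` steps. -/
theorem erase_type11_steps (R : Finset (Set (ℝ × ℝ))) (m : ℕ) (a h : ℕ → ℝ)
    (hR : IsStaircaseWith R m a h) (hcard : 2 ≤ R.card)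
    (x1 x2 y1 y2 : ℝ) (hx : x1 < x2) (hy : y1 < y2)
    (hr : IsDeletable R (Icc x1 x2 ×ˢ Icc y1 y2))
    (j : ℕ) (hj1 : 1 ≤ j) (hjm : j ≤ m)
    (htop : y2 = h j) (hright : x2 = a j)
    (htype1 : a (j - 1) < x1)
    (htype2 : (if j < m then h (j + 1) else 0) < y1) :
    ∃ a' h', IsStaircaseWith (R.erase (Icc x1 x2 ×ˢ Icc y1 y2)) (m + 1) a' h' := by
  obtain ⟨-, hblock, hdisj, hfour, hm, ha0, ha, hh, hpos, hU⟩ := hR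
  obtain ⟨hrR, -⟩ := hr
  subst htop hright
  have hbot : j < m → h (j + 1) < y1 := fun hlt => by rwa [if_pos hlt] at htype2
  have hy0 : 0 < y1 := by
    split_ifs at htype2 with hlt
    · have := le_of_heights_decreasing hh (show 1 ≤ j + 1 by omega) hlt le_rfl
      linarith
    · exact htype2
  set r : Set (ℝ × ℝ) := Icc x1 (a j) ×ˢ Icc y1 (h j)
  have hsub : ∀ {b}, b ∈ R.erase r → b ∈ R := fun hb => Finset.mem_of_mem_erase hb
  have hclosed : IsClosed (⋃₀ (R.erase r : Set (Set (ℝ × ℝ)))) := by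
    rw [sUnion_eq_biUnion]
    exact (R.erase r).finite_toSet.isClosed_biUnion fun b hb => (hblock b (hsub hb)).isClosed
  have hmem : ∀ p ∈ (⋃ i ∈ Finset.Icc 1 m, Icc (a (i - 1)) (a i) ×ˢ Icc (0 : ℝ) (h i)),
      p ∉ r → p ∈ ⋃₀ (R.erase r : Set (Set (ℝ × ℝ))) := by
    intro p hp hpr
    rw [← hU] at hp
    obtain ⟨b, hb, hpb⟩ := hp
    exact ⟨b, Finset.mem_coe.mpr (Finset.mem_erase.mpr ⟨fun hbr => hpr (hbr ▸ hpb), hb⟩), hpb⟩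
  refine ⟨splitAbscissa a j x1, splitHeight h j y1, ?_, fun b hb => hblock b (hsub hb),
    fun b hb b' hb' => hdisj b (hsub hb) b' (hsub hb'),
    fun p b1 b2 b3 b4 h1 h2 h3 h4 =>
      hfour p b1 b2 b3 b4 (hsub h1) (hsub h2) (hsub h3) (hsub h4),
    by omega, ?_, fun i hi => splitAbscissa_lt_succ ha hj1 hjm htype1 hx hi,
    fun i hi him => splitHeight_succ_lt hh hjm hy hbot hi him, ?_, ?_⟩
  · rw [← Finset.card_pos, Finset.card_erase_of_mem hrR]
    omega
  · rw [splitAbscissa, if_pos (by omega), ha0]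
  · unfold splitHeight
    rw [if_neg (by omega), Nat.add_sub_cancel]
    split_ifs
    exacts [hy0, hpos]
  ext p
  rw [mem_splitRegion ha hh hj1 hjm htype1 hx hy hbot]
  constructor
  · rintro ⟨b, hb, hpb⟩
    obtain ⟨hbr, hbR⟩ := Finset.mem_erase.mp (Finset.mem_coe.mp hb)
    have hbU : b ⊆ ⋃ i ∈ Finset.Icc 1 m, Icc (a (i - 1)) (a i) ×ˢ Icc (0 : ℝ) (h i) :=
      hU ▸ subset_sUnion_of_mem (Finset.mem_coe.mpr hbR)
    refine ⟨hbU hpb, ?_⟩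
    by_contra! hp
    have hquad : IsOpen (Ioi x1 ×ˢ Ioi y1) := isOpen_Ioi.prod isOpen_Ioi
    obtain ⟨q, hq, hqb⟩ := mem_closure_iff.mp ((hblock b hbR).subset_closure_interior hpb)
      _ hquad hp
    have hqr : q ∈ interior r :=
      mem_interior.mpr ⟨(Ioi x1 ×ˢ Ioi y1) ∩ interior b, fun z hz =>
        mem_corner_of_mem_stepRegion ha hh hjm htype1 hbot (hbU (interior_subset hz.2))
          hz.1.1 hz.1.2, hquad.inter isOpen_interior, hq, hqb⟩
    exact (hdisj b hbR r hrR hbr).subset ⟨hqb, hqr⟩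
  · rintro ⟨hpU, hp⟩
    by_cases hpr : p ∈ r
    swap
    · exact hmem p hpU hpr
    obtain ⟨x, y⟩ := p
    obtain ⟨⟨hx1, hx2⟩, hy1, hy2⟩ := hpr
    dsimp only at hp hx1 hx2 hy1 hy2
    rcases hp with hp | hp
    · obtain rfl := le_antisymm hp hx1
      have hcl := hclosed.preimage (show Continuous fun t : ℝ => (t, y) by fun_prop)
      refine closure_minimal (s := Ioo (a (j - 1)) x) (fun t ht => ?_) hcl ?_
      · refine hmem _ (mem_stepRegion.mpr ⟨j, hj1, hjm, ht.1.le, by linarith [ht.2], by linarith,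
          hy2⟩) fun htr => ?_
        exact absurd ht.2 (not_lt.mpr htr.1.1)
      · rw [closure_Ioo htype1.ne]
        exact right_mem_Icc.mpr htype1.le
    · obtain rfl := le_antisymm hp hy1
      have hcl := hclosed.preimage (show Continuous fun t : ℝ => (x, t) by fun_prop)
      refine closure_minimal (s := Ioo 0 y) (fun t ht => ?_) hcl ?_
      · refine hmem _ (mem_stepRegion.mpr ⟨j, hj1, hjm, by linarith, hx2, ht.1.le,
          by linarith [ht.2]⟩) fun htr => ?_
        exact absurd ht.2 (not_lt.mpr htr.2.1)
      · rw [closure_Ioo hy0.ne]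
        exact right_mem_Icc.mpr hy0.le
end

section
/- For every n ≥ 1, the number of Baxter permutations of {1,…,n} is at most 2^(3n−3); equivalently, there is an injection from the set of Baxter permutations of {1,…,n} into the set of binary strings of length 3n−3. -/
/-- A permutation `σ` of `{0, …, n-1}` (representing `{1, …, n}`) is a Baxter
permutation if there are no indices `i < j < j+1 < k` with
`σ (j+1) < σ i < σ k < σ j`, and no indices `i < j < j+1 < k` with
`σ j < σ k < σ i < σ (j+1)`. -/
def IsBaxter (n : ℕ) (σ : Equiv.Perm (Fin n)) : Prop :=
  ∀ (i j k : ℕ) (hi : i < n) (hj : j < n) (hj1 : j + 1 < n) (hk : k < n),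
    i < j → j + 1 < k →
    ¬(σ ⟨j + 1, hj1⟩ < σ ⟨i, hi⟩ ∧ σ ⟨i, hi⟩ < σ ⟨k, hk⟩ ∧ σ ⟨k, hk⟩ < σ ⟨j, hj⟩) ∧
    ¬(σ ⟨j, hj⟩ < σ ⟨k, hk⟩ ∧ σ ⟨k, hk⟩ < σ ⟨i, hi⟩ ∧ σ ⟨i, hi⟩ < σ ⟨j + 1, hj1⟩)

namespace List

/-- The number of right-to-left maxima of a list. -/
def rlMax : List ℕ → ℕ
  | [] => 0
  | x :: l => rlMax l + if ∀ y ∈ l, y < x then 1 else 0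

/-- The number of left-to-right maxima of a list. -/
def lrMax (l : List ℕ) : ℕ := rlMax l.reverse

/-- The pattern avoidance condition defining Baxter permutations, for lists. -/
def AvoidsBaxter (l : List ℕ) : Prop :=
  ∀ (P : List ℕ) (a b : ℕ) (S : List ℕ), l = P ++ a :: b :: S → ∀ x ∈ P, ∀ y ∈ S,
    ¬(b < x ∧ x < y ∧ y < a) ∧ ¬(a < y ∧ y < x ∧ x < b)

/-- The weight `2 ^ (lrMax l + rlMax l)`, which on average grows by a factor of at most `8` when a
new maximum is inserted into a Baxter permutation. -/
def maxWeight (l : List ℕ) : ℕ := 2 ^ (lrMax l + rlMax l)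

theorem lrMax_concat (l : List ℕ) (x : ℕ) :
    lrMax (l ++ [x]) = lrMax l + if ∀ y ∈ l, y < x then 1 else 0 := by
  simp [lrMax, rlMax]

theorem maxWeight_reverse (l : List ℕ) : maxWeight l.reverse = maxWeight l := by
  simp [maxWeight, lrMax, add_comm]

theorem rlMax_append_of_lt {A B : List ℕ} {b : ℕ} (hb : b ∈ B) (h : ∀ a ∈ A, a < b) :
    rlMax (A ++ B) = rlMax B := by
  induction A with
  | nil => rfl
  | cons x A ih =>
    have hx : ¬ ∀ y ∈ A ++ B, y < x := fun hy =>
      absurd (hy b (by simp [hb])) (by have := h x (by simp); omega)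
    rw [cons_append, rlMax, if_neg hx, ih fun a ha => h a (by simp [ha]), add_zero]

theorem rlMax_append_cons {A B : List ℕ} {M : ℕ} (hA : ∀ a ∈ A, a < M) (hB : ∀ b ∈ B, b < M) :
    rlMax (A ++ M :: B) = rlMax B + 1 := by
  rw [rlMax_append_of_lt (b := M) (by simp) hA, rlMax, if_pos hB]

theorem lrMax_append_cons {A B : List ℕ} {M : ℕ} (hA : ∀ a ∈ A, a < M) (hB : ∀ b ∈ B, b < M) :
    lrMax (A ++ M :: B) = lrMax A + 1 := by
  have := rlMax_append_cons (A := B.reverse) (B := A.reverse) (M := M)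
    (by simpa using hB) (by simpa using hA)
  simpa [lrMax] using this

theorem one_le_rlMax {l : List ℕ} (h : l ≠ []) : 1 ≤ rlMax l := by
  induction l with
  | nil => exact absurd rfl h
  | cons x l ih =>
    rcases eq_or_ne l [] with rfl | hl
    · simp [rlMax]
    · rw [rlMax]
      exact (ih hl).trans (Nat.le_add_right _ _)

theorem four_le_maxWeight {l : List ℕ} (h : l ≠ []) : 4 ≤ maxWeight l := by
  have h1 := one_le_rlMax h
  have h2 : 1 ≤ lrMax l := one_le_rlMax (by simpa using h)
  calc 4 = 2 ^ 2 := rfl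
    _ ≤ _ := Nat.pow_le_pow_right (by norm_num) (by omega)

/-- The positions of the left-to-right maxima of a list. -/
def lrMaxPositions (l : List ℕ) : Finset ℕ :=
  {p ∈ Finset.range l.length | ∀ y ∈ l.take p, y < l.getD p 0}

theorem sum_two_pow_lrMax_take (l : List ℕ) {m : ℕ} (hm : m ≤ l.length) :
    (∑ p ∈ Finset.range m with ∀ y ∈ l.take p, y < l.getD p 0, 2 ^ lrMax (l.take p)) + 1 =
      2 ^ lrMax (l.take m) := by
  rw [Finset.sum_filter]
  induction m with
  | zero => simp [lrMax, rlMax]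
  | succ m ih =>
    have hlt : m < l.length := hm
    have hget : l.getD m 0 = l[m] := by simp [hlt]
    rw [Finset.sum_range_succ, take_succ_eq_append_getElem hlt, lrMax_concat, hget]
    have := ih (by omega)
    split_ifs
    · rw [pow_succ]; omega
    · simpa using this

/-- Insert `M` at position `p` of a list. -/
def insertMax (M : ℕ) (l : List ℕ) (p : ℕ) : List ℕ := l.take p ++ M :: l.drop p

theorem maxWeight_insertMax {M : ℕ} {l : List ℕ} (hl : ∀ x ∈ l, x < M) {p : ℕ}
    (hp : p ∈ lrMaxPositions l) :
    maxWeight (insertMax M l p) = 2 ^ lrMax (l.take p) * 2 ^ (rlMax l + 2) := by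
  obtain ⟨hp, h⟩ := Finset.mem_filter.1 hp
  have hlt : p < l.length := Finset.mem_range.1 hp
  have hA : ∀ a ∈ l.take p, a < M := fun a ha => hl a (mem_of_mem_take ha)
  have hB : ∀ a ∈ l.drop p, a < M := fun a ha => hl a (mem_of_mem_drop ha)
  have hmem : l.getD p 0 ∈ l.drop p := by
    rw [getD_eq_getElem _ _ hlt, drop_eq_getElem_cons hlt]
    exact mem_cons_self
  have hr := rlMax_append_of_lt hmem h
  rw [take_append_drop] at hr
  rw [maxWeight, insertMax, lrMax_append_cons hA hB, rlMax_append_cons hA hB, ← hr, ← pow_add]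
  congr 1
  ring

theorem sum_maxWeight_insertMax_le {M : ℕ} {l : List ℕ} (hl : ∀ x ∈ l, x < M) :
    ∑ p ∈ lrMaxPositions l, maxWeight (insertMax M l p) ≤ 4 * maxWeight l := by
  rw [Finset.sum_congr rfl fun p hp => maxWeight_insertMax hl hp, ← Finset.sum_mul]
  have h := sum_two_pow_lrMax_take l le_rfl
  rw [take_length] at h
  calc _ ≤ 2 ^ lrMax l * 2 ^ (rlMax l + 2) := by
        gcongr
        exact (Nat.le_succ _).trans h.le
    _ = 4 * maxWeight l := by rw [maxWeight]; ring

/-- Inserting the letter `M` at all sites directly before a left-to-right maximum or directly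
after a right-to-left maximum. -/
def maxInsertions (M : ℕ) (l : List ℕ) : Finset (List ℕ) :=
  (lrMaxPositions l).image (insertMax M l) ∪
    (lrMaxPositions l.reverse).image fun p => (insertMax M l.reverse p).reverse

theorem _root_.Finset.sum_image_le_sum_nat {α β : Type*} [DecidableEq β] (s : Finset α) (g : α → β)
    (f : β → ℕ) : ∑ b ∈ s.image g, f b ≤ ∑ a ∈ s, f (g a) := by
  classical
  induction s using Finset.induction_on with
  | empty => simp
  | insert a s ha ih =>
    rw [Finset.image_insert, Finset.sum_insert ha]
    by_cases h : g a ∈ s.image g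
    · rw [Finset.insert_eq_of_mem h]; omega
    · rw [Finset.sum_insert h]; omega

theorem _root_.Finset.sum_biUnion_le_sum_nat {α β : Type*} [DecidableEq β] (s : Finset α)
    (t : α → Finset β) (f : β → ℕ) : ∑ b ∈ s.biUnion t, f b ≤ ∑ a ∈ s, ∑ b ∈ t a, f b := by
  classical
  induction s using Finset.induction_on with
  | empty => simp
  | insert a s ha ih =>
    rw [Finset.biUnion_insert, Finset.sum_insert ha]
    have := Finset.sum_union_inter (s₁ := t a) (s₂ := s.biUnion t) (f := f)
    omega

theorem sum_maxWeight_maxInsertions_le {M : ℕ} {l : List ℕ} (hl : ∀ x ∈ l, x < M) :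
    ∑ k ∈ maxInsertions M l, maxWeight k ≤ 8 * maxWeight l := by
  have h1 := (Finset.sum_image_le_sum_nat (lrMaxPositions l) (insertMax M l) maxWeight).trans
    (sum_maxWeight_insertMax_le hl)
  have h2 := Finset.sum_image_le_sum_nat (lrMaxPositions l.reverse)
    (fun p => (insertMax M l.reverse p).reverse) maxWeight
  simp only [maxWeight_reverse] at h2
  have h3 := sum_maxWeight_insertMax_le (M := M) (l := l.reverse) (by simpa using hl)
  rw [maxWeight_reverse] at h3
  have h4 := Finset.sum_union_inter (s₁ := (lrMaxPositions l).image (insertMax M l))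
    (s₂ := (lrMaxPositions l.reverse).image fun p => (insertMax M l.reverse p).reverse)
    (f := maxWeight)
  rw [maxInsertions]
  omega

theorem insertMax_mem_maxInsertions {M b : ℕ} {A B : List ℕ} (h : ∀ a ∈ A, a < b) :
    A ++ M :: b :: B ∈ maxInsertions M (A ++ b :: B) := by
  refine Finset.mem_union_left _ (Finset.mem_image.2 ⟨A.length, ?_, by simp [insertMax]⟩)
  simpa [lrMaxPositions] using h

theorem reverse_mem_maxInsertions {M : ℕ} {k l : List ℕ} (h : k ∈ maxInsertions M l) :
    k.reverse ∈ maxInsertions M l.reverse := by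
  simp only [maxInsertions, Finset.mem_union, Finset.mem_image, reverse_reverse] at h ⊢
  rcases h with ⟨p, hp, rfl⟩ | ⟨p, hp, rfl⟩
  · exact Or.inr ⟨p, hp, rfl⟩
  · exact Or.inl ⟨p, hp, by simp⟩

theorem AvoidsBaxter.erase_max {A B : List ℕ} {M : ℕ} (h : AvoidsBaxter (A ++ M :: B))
    (hA : ∀ a ∈ A, a < M) (hB : ∀ b ∈ B, b < M) : AvoidsBaxter (A ++ B) := by
  intro P a b S he x hx y hy
  rcases append_eq_append_iff.1 he with ⟨C, rfl, rfl⟩ | ⟨C, rfl, hC⟩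
  · exact h (A ++ M :: C) a b S (by simp) x (by simp at hx ⊢; tauto) y hy
  · rcases C with _ | ⟨c, _ | ⟨d, C⟩⟩
    · simp only [nil_append] at hC
      subst hC
      exact h (P ++ [M]) a b S (by simp) x (by simp [hx]) y hy
    · simp only [cons_append, nil_append, cons.injEq] at hC
      obtain ⟨rfl, rfl⟩ := hC
      have hxM : x < M := hA x (by simp [hx])
      have hyM : y < M := hB y (by simp [hy])
      have h1 := (h (P ++ [a]) M b S (by simp) x (by simp [hx]) y hy).1
      have h2 := (h P a M (b :: S) (by simp) x hx y (by simp [hy])).2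
      omega
    · simp only [cons_append, cons.injEq] at hC
      obtain ⟨rfl, rfl, rfl⟩ := hC
      exact h P a b (C ++ M :: B) (by simp) x hx y (by simp at hy ⊢; tauto)

theorem AvoidsBaxter.mem_maxInsertions {A B : List ℕ} {M : ℕ} (h : AvoidsBaxter (A ++ M :: B))
    (hA : ∀ a ∈ A, a < M) (hB : ∀ b ∈ B, b < M) (hn : (A ++ B).Nodup) (hne : A ++ B ≠ []) :
    A ++ M :: B ∈ maxInsertions M (A ++ B) := by
  have hright : ∀ (A' : List ℕ) (a : ℕ), A = A' ++ [a] → (∀ b ∈ B, b < a) →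
      A ++ M :: B ∈ maxInsertions M (A ++ B) := by
    rintro A' a rfl hlt
    have := reverse_mem_maxInsertions (insertMax_mem_maxInsertions (M := M) (b := a)
      (A := B.reverse) (B := A'.reverse) (by simpa using hlt))
    simpa using this
  have hdisj := (nodup_append.1 hn).2.2
  rcases B with _ | ⟨b, B⟩
  · rcases eq_nil_or_concat A with rfl | ⟨A', a, rfl⟩
    · simp at hne
    · exact hright A' a (by simp) (by simp)
  · rcases eq_nil_or_concat A with rfl | ⟨A', a, rfl⟩
    · exact insertMax_mem_maxInsertions (by simp)
    · have hbM : b < M := hB b (by simp)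
      have haM : a < M := hA a (by simp)
      rcases lt_or_ge a b with hab | hab
      · refine insertMax_mem_maxInsertions fun c hc => ?_
        have hcb : c ≠ b := hdisj c hc b (by simp)
        have hcM := hA c hc
        rcases mem_append.1 (concat_eq_append ▸ hc) with hc' | hc'
        · have := (h A' a M (b :: B) (by simp) c hc' b (by simp)).2
          omega
        · rw [mem_singleton] at hc'; omega
      · refine hright A' a (by simp) fun c hc => ?_
        have hca : a ≠ c := hdisj a (by simp) c hc
        have hba : a ≠ b := hdisj a (by simp) b (by simp)
        have hcM := hB c hc
        rcases mem_cons.1 hc with rfl | hc'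
        · omega
        · have := (h (A' ++ [a]) M b B (by simp) a (by simp) c hc').1
          omega

open Classical in
/-- The Baxter permutations of `{0, …, n - 1}` as lists. -/
noncomputable def baxterLists (n : ℕ) : Finset (List ℕ) :=
  {l ∈ (range n).permutations.toFinset | AvoidsBaxter l}

theorem mem_baxterLists {n : ℕ} {l : List ℕ} :
    l ∈ baxterLists n ↔ l ~ range n ∧ AvoidsBaxter l := by
  simp [baxterLists]

theorem baxterLists_succ_subset {n : ℕ} (hn : 1 ≤ n) :
    baxterLists (n + 1) ⊆ (baxterLists n).biUnion (maxInsertions n) := by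
  intro l hl
  obtain ⟨hp, hb⟩ := mem_baxterLists.1 hl
  obtain ⟨A, B, rfl⟩ := append_of_mem (hp.mem_iff.2 (by simp : n ∈ range (n + 1)))
  have hp' : A ++ B ~ range n := by
    have h1 : n :: (A ++ B) ~ n :: range n := by
      refine perm_middle.symm.trans (hp.trans ?_)
      rw [range_succ]
      exact perm_append_singleton _ _
    exact h1.cons_inv
  have hlt : ∀ x ∈ A ++ B, x < n := fun x hx => mem_range.1 (hp'.mem_iff.1 hx)
  have hA : ∀ x ∈ A, x < n := fun x hx => hlt x (mem_append_left _ hx)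
  have hB : ∀ x ∈ B, x < n := fun x hx => hlt x (mem_append_right _ hx)
  refine Finset.mem_biUnion.2 ⟨A ++ B, mem_baxterLists.2 ⟨hp', hb.erase_max hA hB⟩,
    hb.mem_maxInsertions hA hB (hp'.nodup_iff.2 nodup_range) fun h => ?_⟩
  have := hp'.length_eq
  rw [h, length_range] at this
  simp at this
  omega

theorem sum_maxWeight_baxterLists_le (n : ℕ) :
    ∑ l ∈ baxterLists (n + 1), maxWeight l ≤ 4 * 8 ^ n := by
  induction n with
  | zero =>
    have h : baxterLists 1 ⊆ {[0]} := fun l hl => by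
      simpa using (mem_baxterLists.1 hl).1
    refine (Finset.sum_le_sum_of_subset h).trans ?_
    simp [maxWeight, lrMax, rlMax]
  | succ n ih =>
    calc ∑ l ∈ baxterLists (n + 1 + 1), maxWeight l
        ≤ ∑ l ∈ (baxterLists (n + 1)).biUnion (maxInsertions (n + 1)), maxWeight l :=
          Finset.sum_le_sum_of_subset (baxterLists_succ_subset (by omega))
      _ ≤ ∑ l ∈ baxterLists (n + 1), ∑ k ∈ maxInsertions (n + 1) l, maxWeight k :=
          Finset.sum_biUnion_le_sum_nat _ _ _
      _ ≤ ∑ l ∈ baxterLists (n + 1), 8 * maxWeight l :=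
          Finset.sum_le_sum fun l hl => sum_maxWeight_maxInsertions_le fun x hx =>
            mem_range.1 ((mem_baxterLists.1 hl).1.mem_iff.1 hx)
      _ ≤ 4 * 8 ^ (n + 1) := by
          rw [← Finset.mul_sum, pow_succ]
          omega

theorem card_baxterLists_le (n : ℕ) : (baxterLists (n + 1)).card ≤ 8 ^ n := by
  have h : ∑ l ∈ baxterLists (n + 1), 4 ≤ ∑ l ∈ baxterLists (n + 1), maxWeight l :=
    Finset.sum_le_sum fun l hl => four_le_maxWeight fun h => by
      have := (mem_baxterLists.1 hl).1.length_eq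
      simp [h] at this
  have := sum_maxWeight_baxterLists_le n
  rw [Finset.sum_const, smul_eq_mul] at h
  omega

end List

theorem IsBaxter.ofFn_mem_baxterLists {n : ℕ} {σ : Equiv.Perm (Fin n)} (h : IsBaxter n σ) :
    List.ofFn (fun i => (σ i : ℕ)) ∈ List.baxterLists n := by
  refine List.mem_baxterLists.2 ⟨?_, ?_⟩
  · refine (List.perm_ext_iff_of_nodup (List.nodup_ofFn.2 ?_) List.nodup_range).2 fun x => ?_
    · exact Fin.val_injective.comp σ.injective
    · rw [List.mem_ofFn, List.mem_range]
      constructor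
      · rintro ⟨i, rfl⟩
        exact (σ i).2
      · intro hx
        exact ⟨σ.symm ⟨x, hx⟩, by simp⟩
  · intro P a b S he x hx y hy
    obtain ⟨i, hi, rfl⟩ := List.getElem_of_mem hx
    obtain ⟨k, hk, rfl⟩ := List.getElem_of_mem hy
    have hlen : n = P.length + (S.length + 2) := by simpa using congrArg List.length he
    have key : ∀ (m : ℕ) (hm : m < n), ((σ ⟨m, hm⟩ : Fin n) : ℕ) =
        (P ++ a :: b :: S)[m]'(by simp; omega) := by
      intro m hm
      simp [← he]
    have := h i P.length (P.length + 2 + k) (by omega) (by omega) (by omega) (by omega) hi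
      (by omega)
    simp only [Fin.lt_def, key] at this
    have e : P.length + 2 + k - P.length = k + 2 := by omega
    simpa [List.getElem_append, hi, add_assoc, add_comm 2 k] using this


/-- For every `n ≥ 1`, the number of Baxter permutations of
`{1, …, n}` is at most `2 ^ (3n - 3)`; equivalently, there is an injection from
the Baxter permutations of `{1, …, n}` into the binary strings of length `3n - 3`. -/
theorem baxter_card_le (n : ℕ) (hn : 1 ≤ n) :
    Nat.card {σ : Equiv.Perm (Fin n) // IsBaxter n σ} ≤ 2 ^ (3 * n - 3) ∧
      ∃ f : {σ : Equiv.Perm (Fin n) // IsBaxter n σ} → (Fin (3 * n - 3) → Bool),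
        Function.Injective f := by
  have hcard : Nat.card {σ : Equiv.Perm (Fin n) // IsBaxter n σ} ≤ 2 ^ (3 * n - 3) := by
    let g : {σ : Equiv.Perm (Fin n) // IsBaxter n σ} → List.baxterLists n :=
      fun σ => ⟨_, σ.2.ofFn_mem_baxterLists⟩
    have hg : Function.Injective g := by
      intro σ τ h
      have h' := List.ofFn_injective (congrArg Subtype.val h)
      exact Subtype.ext (Equiv.ext fun i => Fin.ext (congrFun h' i))
    obtain ⟨m, rfl⟩ := Nat.exists_eq_add_of_le' hn
    calc _ ≤ Nat.card (List.baxterLists (m + 1)) := Nat.card_le_card_of_injective g hg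
      _ = (List.baxterLists (m + 1)).card := by simp
      _ ≤ 8 ^ m := List.card_baxterLists_le m
      _ = 2 ^ (3 * (m + 1) - 3) := by
        rw [show 3 * (m + 1) - 3 = 3 * m by omega, pow_mul]
        norm_num
  refine ⟨hcard, ?_⟩
  classical
  have : Fintype.card {σ : Equiv.Perm (Fin n) // IsBaxter n σ} ≤
      Fintype.card (Fin (3 * n - 3) → Bool) := by
    simpa [Nat.card_eq_fintype_card] using hcard
  obtain ⟨f⟩ := Function.Embedding.nonempty_of_card_le this
  exact ⟨f, f.injective⟩
end

section
/- For every n ≥ 1, the n-th Baxter number B(n) satisfies B(n) ≤ 2^(3n−3); equivalently, ∑_{r=0}^{n−1} C(n+1,r)·C(n+1,r+1)·C(n+1,r+2) ≤ C(n+1,1)·C(n+1,2)·2^(3n−3), where C(a,b) denotes the binomial coefficient. -/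
/-- The sum of products of three consecutive entries of a row of Pascal's triangle is bounded by the
cube of the row sum. -/
theorem sum_choose_mul_choose_succ_mul_choose_add_two_le (n : ℕ) :
    ∑ r ∈ Finset.range n,
        (n + 1).choose r * (n + 1).choose (r + 1) * (n + 1).choose (r + 2) ≤
      (2 ^ (n + 1)) ^ 3 := by
  calc
    _ ≤ ∑ r ∈ Finset.range n, (n + 1).choose r * 2 ^ (n + 1) * 2 ^ (n + 1) := by
      gcongr <;> exact Nat.choose_le_two_pow _ _
    _ = (∑ r ∈ Finset.range n, (n + 1).choose r) * 2 ^ (n + 1) * 2 ^ (n + 1) := by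
      simp only [Finset.sum_mul]
    _ ≤ (∑ r ∈ Finset.range (n + 1 + 1), (n + 1).choose r) * 2 ^ (n + 1) * 2 ^ (n + 1) := by
      gcongr
      omega
    _ = (2 ^ (n + 1)) ^ 3 := by
      rw [Nat.sum_range_choose]
      ring

/-- For every `n ≥ 1`, the `n`-th Baxter number
`B(n) = C(n+1,1)⁻¹ · C(n+1,2)⁻¹ · ∑_{r=0}^{n-1} C(n+1,r)·C(n+1,r+1)·C(n+1,r+2)`
satisfies `B(n) ≤ 2 ^ (3n - 3)`; equivalently,
`∑_{r=0}^{n-1} C(n+1,r)·C(n+1,r+1)·C(n+1,r+2) ≤ C(n+1,1)·C(n+1,2)·2^(3n-3)`. -/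
theorem baxter_number_le (n : ℕ) (hn : 1 ≤ n) :
    ∑ r ∈ Finset.range n,
        (n + 1).choose r * (n + 1).choose (r + 1) * (n + 1).choose (r + 2) ≤
      (n + 1).choose 1 * (n + 1).choose 2 * 2 ^ (3 * n - 3) := by
  rcases le_or_gt n 4 with h | h
  · interval_cases n <;> decide
  · refine (sum_choose_mul_choose_succ_mul_choose_add_two_le n).trans ?_
    have hpow : (2 ^ (n + 1)) ^ 3 = 64 * 2 ^ (3 * n - 3) := by
      rw [← pow_mul, show (n + 1) * 3 = 6 + (3 * n - 3) by omega, pow_add]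
      norm_num
    have hchoose : Nat.choose 6 2 ≤ (n + 1).choose 2 := Nat.choose_le_choose 2 (by omega)
    have hsix : Nat.choose 6 2 = 15 := by decide
    rw [hpow, Nat.choose_one_right]
    gcongr
    nlinarith
end
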